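/- For μ = (μ_1, μ_2, μ_3, μ_4), in the super Yangian Y_{(μ_1,μ_2,μ_3,μ_4)} one has [E_{1,3;i,j}(u), sum_{q=1}^{μ_3} E_{2;h,q}(v) E_{3;q,k}(v) - E_{2,4;h,k}(v)] = 0 for all 1 ≤ i ≤ μ_1, 1 ≤ h ≤ μ_2, 1 ≤ j ≤ μ_3, 1 ≤ k ≤ μ_4. -/

import Mathlib

noncomputable section

namespace SuperYangian

/-- The sign `(-1)^x` for `x : ZMod 2`. -/
def sgn (x : ZMod 2) : ℂ := if x = 0 then 1 else -1

variable {A : Type*}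

/-- The supercommutator `[x, y] = x*y - ε • (y*x)` with prescribed sign `ε`
(for homogeneous `x`, `y` one takes `ε = (-1)^{|x||y|}`). -/
def scomm [Ring A] [Algebra ℂ A] (ε : ℂ) (x y : A) : A := x * y - ε • (y * x)

/-- `off μ a = μ 0 + ⋯ + μ (a-1)`. -/
def off (μ : ℕ → ℕ) (a : ℕ) : ℕ := ∑ b ∈ Finset.range a, μ b

/-- A family `t i j r` (the coefficient of `u^{-r}` in `t_{ij}(u)`, with 0-based
indices `i j < d`) satisfying the defining RTT relations of the super Yangian
`Y(gl_{M|N})` with parity sequence `p`; the super Yangian itself, via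
`t_{i+1,j+1}^{(r)} = t i j r`, is the universal such family. -/
structure RTT (A : Type*) [Ring A] [Algebra ℂ A] (d : ℕ) (p : ℕ → ZMod 2) where
  t : ℕ → ℕ → ℕ → A
  t_zero : ∀ i j, t i j 0 = if i = j then (1 : A) else 0
  rtt : ∀ i j h k r s : ℕ, i < d → j < d → h < d → k < d →
    scomm (sgn ((p i + p j) * (p h + p k))) (t i j r) (t h k s) =
      sgn (p i * p j + p i * p h + p j * p h) •
        ∑ g ∈ Finset.range (min r s),
          (t h j g * t i k (r + s - 1 - g) - t h j (r + s - 1 - g) * t i k g)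

/-- Gauss decomposition data `T(u) = F(u) D(u) E(u)` with respect to the composition
`μ = (μ 0, …, μ (n-1))`, in coefficient form.  `E a b i j r` is the coefficient of
`u^{-r}` in the `(i,j)`-entry of the block `E_{a,b}(u)` (0-based blocks and entries),
extended by the identity on the diagonal blocks and by `0` below them; similarly `F`.
`D a` are the diagonal blocks and `D' a` their inverses.  Since the Gauss
decomposition is unique, this data consists exactly of the quasideterminant blocks. -/
structure Gauss [Ring A] [Algebra ℂ A] (T : ℕ → ℕ → ℕ → A) (n : ℕ) (μ : ℕ → ℕ) where
  D : ℕ → ℕ → ℕ → ℕ → A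
  D' : ℕ → ℕ → ℕ → ℕ → A
  E : ℕ → ℕ → ℕ → ℕ → ℕ → A
  F : ℕ → ℕ → ℕ → ℕ → ℕ → A
  E_diag : ∀ a i j r, E a a i j r = if i = j ∧ r = 0 then 1 else 0
  E_low : ∀ a b i j r, b < a → E a b i j r = 0
  E_zero : ∀ a b i j, a < b → E a b i j 0 = 0
  F_diag : ∀ a i j r, F a a i j r = if i = j ∧ r = 0 then 1 else 0
  F_high : ∀ a b i j r, a < b → F a b i j r = 0
  F_zero : ∀ a b i j, b < a → F a b i j 0 = 0
  D_zero : ∀ a i j, D a i j 0 = if i = j then (1 : A) else 0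
  D_inv : ∀ a i j r, a < n → i < μ a → j < μ a →
    ∑ q ∈ Finset.range (μ a), ∑ e ∈ Finset.range (r + 1), D a i q e * D' a q j (r - e) =
      if i = j ∧ r = 0 then 1 else 0
  D_inv' : ∀ a i j r, a < n → i < μ a → j < μ a →
    ∑ q ∈ Finset.range (μ a), ∑ e ∈ Finset.range (r + 1), D' a i q e * D a q j (r - e) =
      if i = j ∧ r = 0 then 1 else 0
  decomp : ∀ a b i j r, a < n → b < n → i < μ a → j < μ b →
    T (off μ a + i) (off μ b + j) r =
      ∑ c ∈ Finset.range n, ∑ q1 ∈ Finset.range (μ c), ∑ q2 ∈ Finset.range (μ c),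
        ∑ e1 ∈ Finset.range (r + 1), ∑ e2 ∈ Finset.range (r + 1 - e1),
          F a c i q1 e1 * D c q1 q2 e2 * E c b q2 j (r - e1 - e2)

open Matrix PowerSeries

lemma sgn_zero : sgn 0 = 1 := if_pos rfl

lemma sgn_add (a b : ZMod 2) : sgn (a + b) = sgn a * sgn b := by
  have hcases : ∀ x : ZMod 2, x = 0 ∨ x = 1 := by decide
  have h11 : (1 : ZMod 2) + 1 = 0 := by decide
  rcases hcases a with rfl | rfl <;> rcases hcases b with rfl | rfl <;> simp [sgn, h11]

lemma sgn_mul_self (a : ZMod 2) : sgn a * sgn a = 1 := by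
  unfold sgn
  split_ifs <;> simp

lemma parity_add_cancel : ∀ a b c : ZMod 2, (a + b) + (b + c) = a + c := by decide

/-- Supercommutation of two elements of parities `a` and `b`. -/
def SuperCommute [Ring A] [Algebra ℂ A] (a b : ZMod 2) (x y : A) : Prop :=
  x * y = sgn (a * b) • (y * x)

namespace SuperCommute

variable [Ring A] [Algebra ℂ A] {a b c : ZMod 2} {x y z : A}

lemma symm (h : SuperCommute a b x y) : SuperCommute b a y x := by
  unfold SuperCommute at *
  rw [h, smul_smul, mul_comm b a, sgn_mul_self, one_smul]

lemma zero_left : SuperCommute a b 0 y := by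
  simp [SuperCommute]

lemma mul_left (hx : SuperCommute a c x z) (hy : SuperCommute b c y z) :
    SuperCommute (a + b) c (x * y) z := by
  unfold SuperCommute at *
  rw [mul_assoc, hy, mul_smul_comm, ← mul_assoc, hx, smul_mul_assoc, smul_smul, mul_assoc,
    add_mul, sgn_add, mul_comm (sgn (b * c))]

lemma sum_left {ι : Type*} {s : Finset ι} {f : ι → A}
    (h : ∀ l ∈ s, SuperCommute a b (f l) y) : SuperCommute a b (∑ l ∈ s, f l) y := by
  unfold SuperCommute at *
  rw [Finset.sum_mul, Finset.mul_sum, Finset.smul_sum]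
  exact Finset.sum_congr rfl h

end SuperCommute

section MatrixSeries

variable {I : Type*} [Fintype I] [DecidableEq I]

lemma coeff_mul_entry [Ring A] (f g : (Matrix I I A)⟦X⟧) (r : ℕ) (x y : I) :
    coeff r (f * g) x y =
      ∑ z, ∑ e ∈ Finset.range (r + 1), coeff e f x z * coeff (r - e) g z y := by
  rw [PowerSeries.coeff_mul, Finset.Nat.sum_antidiagonal_eq_sum_range_succ
    (fun e e' => coeff e f * coeff e' g), Matrix.sum_apply, Finset.sum_comm]
  simp only [Matrix.mul_apply]

lemma coeff_mul_entry_of_row_eq_one [Ring A] {f : (Matrix I I A)⟦X⟧} {x : I}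
    (h : ∀ e z, coeff e f x z = coeff e (1 : (Matrix I I A)⟦X⟧) x z)
    (g : (Matrix I I A)⟦X⟧) (r : ℕ) (y : I) : coeff r (f * g) x y = coeff r g x y := by
  conv_rhs => rw [← one_mul g]
  simp only [coeff_mul_entry, h]

lemma coeff_mul_entry_of_col_eq_one [Ring A] {g : (Matrix I I A)⟦X⟧} {y : I}
    (h : ∀ e z, coeff e g z y = coeff e (1 : (Matrix I I A)⟦X⟧) z y)
    (f : (Matrix I I A)⟦X⟧) (r : ℕ) (x : I) : coeff r (f * g) x y = coeff r f x y := by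
  conv_rhs => rw [← mul_one f]
  simp only [coeff_mul_entry, h]

variable [Ring A] [Algebra ℂ A]

/-- The diagonal matrix which commutes with a matrix exactly when the element `x` of parity `b`
supercommutes with its entries, the `(h, k)`-entry having parity `P h + P k`. -/
def twist (P : I → ZMod 2) (b : ZMod 2) (x : A) : Matrix I I A :=
  Matrix.diagonal fun h => sgn (b * P h) • x

lemma twist_mul_sub_mul_twist (P : I → ZMod 2) (b : ZMod 2) (x : A) (N : Matrix I I A)
    (h k : I) : (twist P b x * N - N * twist P b x) h k =
      sgn (b * P h) • scomm (sgn (b * (P h + P k))) x (N h k) := by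
  have hs : sgn (b * P h) * (sgn (b * P h) * sgn (b * P k)) = sgn (b * P k) := by
    rw [← mul_assoc, sgn_mul_self, one_mul]
  simp only [twist, Matrix.sub_apply, Matrix.diagonal_mul, Matrix.mul_diagonal, scomm, smul_sub,
    smul_smul, mul_add, sgn_add, hs, smul_mul_assoc, mul_smul_comm]

lemma twist_entry_iff (P : I → ZMod 2) (b : ZMod 2) (x : A) (N : Matrix I I A) (h k : I) :
    (twist P b x * N - N * twist P b x) h k = 0 ↔ SuperCommute b (P h + P k) x (N h k) := by
  rw [twist_mul_sub_mul_twist]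
  constructor
  · intro H
    have H' := congrArg (sgn (b * P h) • ·) H
    simp only [smul_smul, sgn_mul_self, one_smul, smul_zero] at H'
    exact sub_eq_zero.1 H'
  · intro H
    rw [scomm, sub_eq_zero.2 H, smul_zero]

lemma commute_C_twist_iff (P : I → ZMod 2) (b : ZMod 2) (x : A) (f : (Matrix I I A)⟦X⟧) :
    Commute (C (twist P b x)) f ↔
      ∀ r h k, SuperCommute b (P h + P k) x (coeff r f h k) := by
  simp only [← twist_entry_iff]
  constructor
  · intro H r h k
    have H' := congrArg (coeff r) H.eq
    rw [coeff_C_mul, coeff_mul_C] at H'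
    rw [H', sub_self, Matrix.zero_apply]
  · intro H
    refine PowerSeries.ext fun r => ?_
    rw [coeff_C_mul, coeff_mul_C]
    exact sub_eq_zero.1 (Matrix.ext (H r))

/-- An element which supercommutes with the entries of an invertible matrix supercommutes with the
entries of the inverse matrix. -/
lemma SuperCommute.inverse_entry {P : I → ZMod 2} {b : ZMod 2} {x : A}
    {f g : (Matrix I I A)⟦X⟧} (hfg : f * g = 1) (hgf : g * f = 1)
    (H : ∀ r h k, SuperCommute b (P h + P k) x (coeff r f h k)) (r : ℕ) (h k : I) :
    SuperCommute b (P h + P k) x (coeff r g h k) := by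
  have hc : Commute (C (twist P b x))
      ((⟨f, g, hfg, hgf⟩ : (Matrix I I A)⟦X⟧ˣ) : (Matrix I I A)⟦X⟧) :=
    (commute_C_twist_iff P b x f).2 H
  exact (commute_C_twist_iff P b x g).1 hc.units_inv_right r h k

end MatrixSeries

section Inverse

variable [Ring A] [Algebra ℂ A]

lemma RTT.rtt_succ {d : ℕ} {p : ℕ → ZMod 2} (S : RTT A d p) {i j h k : ℕ} (hi : i < d)
    (hj : j < d) (hh : h < d) (hk : k < d) (r s : ℕ) :
    scomm (sgn ((p i + p j) * (p h + p k))) (S.t i j (r + 1)) (S.t h k s) -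
      scomm (sgn ((p i + p j) * (p h + p k))) (S.t i j r) (S.t h k (s + 1)) =
    sgn (p i * p j + p i * p h + p j * p h) •
      (S.t h j r * S.t i k s - S.t h j s * S.t i k r) := by
  rw [S.rtt i j h k _ _ hi hj hh hk, S.rtt i j h k _ _ hi hj hh hk, ← smul_sub]
  congr 1
  rw [show r + 1 + s - 1 = r + s by omega, show r + (s + 1) - 1 = r + s by omega]
  rcases lt_trichotomy s r with hlt | rfl | hlt
  · rw [min_eq_right (by omega), min_eq_right (by omega), Finset.sum_range_succ,
      Nat.add_sub_cancel]
    abel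
  · rw [min_eq_right (by omega), min_eq_left (by omega), sub_self, sub_self]
  · rw [min_eq_left (by omega), min_eq_left (by omega), Finset.sum_range_succ,
      Nat.add_sub_cancel_left]
    abel

variable {I : Type*} [Fintype I] [DecidableEq I]

/-- If `t (r)` are the coefficients of a matrix series satisfying the RTT relations, then
`t_{ij}(u)` supercommutes with `t'_{hk}(v)` whenever `h ≠ j` and `k ≠ i`. -/
lemma superCommute_entry_inverse_entry {P : I → ZMod 2} {f g : (Matrix I I A)⟦X⟧}
    (h0 : coeff 0 f = 1) (hfg : f * g = 1) (hgf : g * f = 1)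
    (hrtt : ∀ i j h k r s,
      scomm (sgn ((P i + P j) * (P h + P k))) (coeff (r + 1) f i j) (coeff s f h k) -
        scomm (sgn ((P i + P j) * (P h + P k))) (coeff r f i j) (coeff (s + 1) f h k) =
      sgn (P i * P j + P i * P h + P j * P h) •
        (coeff r f h j * coeff s f i k - coeff s f h j * coeff r f i k))
    {i j h k : I} (hj : h ≠ j) (hi : k ≠ i) (r s : ℕ) :
    SuperCommute (P i + P j) (P h + P k) (coeff r f i j) (coeff s g h k) := by
  let Y : ℕ → Matrix I I A := fun r => twist P (P i + P j) (coeff r f i j)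
  let E : Matrix I I A := Matrix.single j i (algebraMap ℂ A (sgn (P i * P j)))
  have hstep : ∀ r s, (Y (r + 1) * coeff s f - coeff s f * Y (r + 1)) -
      (Y r * coeff (s + 1) f - coeff (s + 1) f * Y r) =
      coeff r f * E * coeff s f - coeff s f * E * coeff r f := by
    intro r s
    ext x y
    have hentry : ∀ M N : Matrix I I A, (M * E * N) x y = sgn (P i * P j) • (M x j * N i y) := by
      intro M N
      rw [Matrix.mul_assoc, Matrix.mul_apply, Finset.sum_eq_single j]
      · rw [Matrix.single_mul_apply_same, Algebra.smul_def, ← mul_assoc, ← mul_assoc,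
          Algebra.commutes]
      · intro z _ hz
        rw [Matrix.single_mul_apply_of_ne _ _ _ _ _ hz, mul_zero]
      · simp
    rw [Matrix.sub_apply, twist_mul_sub_mul_twist, twist_mul_sub_mul_twist, ← smul_sub, hrtt,
      Matrix.sub_apply, hentry, hentry, ← smul_sub, smul_smul]
    congr 1
    simp only [add_mul, sgn_add]
    linear_combination (sgn (P i * P j)) * (sgn (P j * P x) * sgn (P j * P x)) *
      sgn_mul_self (P i * P x) + sgn (P i * P j) * sgn_mul_self (P j * P x)
  have hseries : ∀ r, X * (C (Y (r + 1)) * f - f * C (Y (r + 1))) - (C (Y r) * f - f * C (Y r)) =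
      X * (C (coeff r f * E) * f - f * C (E * coeff r f)) := by
    intro r
    refine PowerSeries.ext fun s => ?_
    cases s with
    | zero =>
      simp only [map_sub, coeff_zero_X_mul, coeff_C_mul, coeff_mul_C, h0, mul_one, one_mul,
        sub_self]
    | succ s =>
      simp only [map_sub, coeff_succ_X_mul, coeff_C_mul, coeff_mul_C, hstep, mul_assoc]
  have hconj : ∀ M N : (Matrix I I A)⟦X⟧, g * (M * f - f * N) * g = g * M - N * g := by
    intro M N
    rw [mul_sub, sub_mul, mul_assoc, mul_assoc, hfg, mul_one, ← mul_assoc g f, hgf, one_mul]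
  have hinv : ∀ r, X * (g * C (Y (r + 1)) - C (Y (r + 1)) * g) - (g * C (Y r) - C (Y r) * g) =
      X * (g * C (coeff r f * E) - C (E * coeff r f) * g) := by
    intro r
    have hX : ∀ M : (Matrix I I A)⟦X⟧, g * (X * M) * g = X * (g * M * g) := by
      intro M
      rw [← mul_assoc g, ← X_mul, mul_assoc, mul_assoc, mul_assoc]
    rw [← hconj, ← hconj, ← hconj, ← hX, ← hX, ← hseries, ← sub_mul, ← mul_sub]
  have hentry : ∀ r s, (Y r * coeff s g - coeff s g * Y r) h k = 0 := by
    intro r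
    induction r with
    | zero =>
      intro s
      rw [twist_entry_iff, h0]
      rcases eq_or_ne i j with rfl | hij
      · have h2 : P i + P i = 0 := CharTwo.add_self_eq_zero _
        simp [SuperCommute, h2, sgn_zero]
      · rw [Matrix.one_apply_ne hij]
        exact SuperCommute.zero_left
    | succ r ih =>
      intro s
      have H := congrArg (coeff (s + 1)) (hinv r)
      simp only [map_sub, coeff_succ_X_mul, coeff_C_mul, coeff_mul_C] at H
      replace H := Matrix.ext_iff.2 H h k
      have hE1 : (coeff s g * (coeff r f * E)) h k = 0 := by
        rw [← mul_assoc]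
        exact Matrix.mul_single_apply_of_ne _ _ _ _ _ hi _
      have hE2 : (E * coeff r f * coeff s g) h k = 0 := by
        rw [mul_assoc]
        exact Matrix.single_mul_apply_of_ne _ _ _ _ _ hj _
      have hr := ih (s + 1)
      rw [Matrix.sub_apply, Matrix.sub_apply (_ * _), Matrix.sub_apply (_ * _),
        Matrix.sub_apply (_ * _), hE1, hE2] at H
      rw [Matrix.sub_apply, sub_eq_zero] at hr ⊢
      rw [hr, sub_self, sub_zero, sub_zero, sub_eq_zero] at H
      exact H.symm
  exact (twist_entry_iff P _ _ _ h k).1 (hentry r s)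

end Inverse

section Blocks

/-- Row and column indices, grouped into `n` blocks of sizes `μ 0, …, μ (n - 1)`. -/
abbrev BlockIndex (n : ℕ) (μ : ℕ → ℕ) : Type := Σ a : Fin n, Fin (μ a)

/-- The position of a block index in `0, …, off μ n - 1`. -/
def pos {n : ℕ} {μ : ℕ → ℕ} (x : BlockIndex n μ) : ℕ := off μ x.1 + x.2

lemma off_add_le_off {μ : ℕ → ℕ} {a b : ℕ} (hab : a < b) : off μ a + μ a ≤ off μ b := by
  rw [off, ← Finset.sum_range_succ]
  exact Finset.sum_le_sum_of_subset (Finset.range_mono hab)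

lemma pos_lt {n : ℕ} {μ : ℕ → ℕ} (x : BlockIndex n μ) : pos x < off μ n := by
  have h := off_add_le_off (μ := μ) x.1.isLt
  have h2 := x.2.isLt
  unfold pos
  omega

lemma pos_injective {n : ℕ} {μ : ℕ → ℕ} :
    Function.Injective (pos : BlockIndex n μ → ℕ) := by
  rintro ⟨a, i⟩ ⟨b, j⟩ h
  simp only [pos] at h
  have hi := i.isLt
  have hj := j.isLt
  rcases lt_trichotomy a b with hab | rfl | hab
  · have := off_add_le_off (μ := μ) (Fin.lt_def.1 hab)
    omega
  · congr 1
    ext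
    omega
  · have := off_add_le_off (μ := μ) (Fin.lt_def.1 hab)
    omega

variable [Ring A] {n : ℕ} {μ : ℕ → ℕ}

/-- The generating matrix series of a family of coefficients indexed by positions. -/
def posSeries (n : ℕ) (μ : ℕ → ℕ) (t : ℕ → ℕ → ℕ → A) :
    (Matrix (BlockIndex n μ) (BlockIndex n μ) A)⟦X⟧ :=
  PowerSeries.mk fun r => Matrix.of fun x y => t (pos x) (pos y) r

/-- The matrix series with given blocks. -/
def blockSeries (n : ℕ) (μ : ℕ → ℕ) (B : ℕ → ℕ → ℕ → ℕ → ℕ → A) :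
    (Matrix (BlockIndex n μ) (BlockIndex n μ) A)⟦X⟧ :=
  PowerSeries.mk fun r => Matrix.of fun x y => B x.1 y.1 x.2 y.2 r

/-- The square matrix series with given coefficients of entries. -/
def squareSeries (m : ℕ) (B : ℕ → ℕ → ℕ → A) : (Matrix (Fin m) (Fin m) A)⟦X⟧ :=
  PowerSeries.mk fun r => Matrix.of fun i j => B i j r

/-- The block diagonal matrix series with given diagonal blocks. -/
def diagSeries (n : ℕ) (μ : ℕ → ℕ) (B : ℕ → ℕ → ℕ → ℕ → A) :
    (Matrix (BlockIndex n μ) (BlockIndex n μ) A)⟦X⟧ :=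
  PowerSeries.mk fun r => Matrix.blockDiagonal' fun a : Fin n => Matrix.of fun i j => B a i j r

@[simp]
lemma coeff_posSeries (t : ℕ → ℕ → ℕ → A) (r : ℕ) (x y : BlockIndex n μ) :
    coeff r (posSeries n μ t) x y = t (pos x) (pos y) r := by
  rw [posSeries, coeff_mk, Matrix.of_apply]

@[simp]
lemma coeff_blockSeries (B : ℕ → ℕ → ℕ → ℕ → ℕ → A) (r : ℕ) (x y : BlockIndex n μ) :
    coeff r (blockSeries n μ B) x y = B x.1 y.1 x.2 y.2 r := by
  rw [blockSeries, coeff_mk, Matrix.of_apply]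

@[simp]
lemma coeff_squareSeries {m : ℕ} (B : ℕ → ℕ → ℕ → A) (r : ℕ) (i j : Fin m) :
    coeff r (squareSeries m B) i j = B i j r := by
  rw [squareSeries, coeff_mk, Matrix.of_apply]

@[simp]
lemma coeff_diagSeries_self (B : ℕ → ℕ → ℕ → ℕ → A) (r : ℕ) (a : Fin n) (i j : Fin (μ a)) :
    coeff r (diagSeries n μ B) ⟨a, i⟩ ⟨a, j⟩ = B a i j r := by
  rw [diagSeries, coeff_mk, Matrix.blockDiagonal'_apply_eq, Matrix.of_apply]

lemma coeff_diagSeries_of_ne (B : ℕ → ℕ → ℕ → ℕ → A) (r : ℕ) {a b : Fin n} (hab : a ≠ b)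
    (i : Fin (μ a)) (j : Fin (μ b)) : coeff r (diagSeries n μ B) ⟨a, i⟩ ⟨b, j⟩ = 0 := by
  rw [diagSeries, coeff_mk, Matrix.blockDiagonal'_apply_ne _ _ _ hab]

lemma coeff_diagSeries_mul (B : ℕ → ℕ → ℕ → ℕ → A)
    (g : (Matrix (BlockIndex n μ) (BlockIndex n μ) A)⟦X⟧) (r : ℕ) (a : Fin n) (i : Fin (μ a))
    (y : BlockIndex n μ) :
    coeff r (diagSeries n μ B * g) ⟨a, i⟩ y =
      ∑ q : Fin (μ a), ∑ e ∈ Finset.range (r + 1), B a i q e * coeff (r - e) g ⟨a, q⟩ y := by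
  rw [coeff_mul_entry, Fintype.sum_sigma, Finset.sum_eq_single a]
  · simp only [coeff_diagSeries_self]
  · intro b _ hb
    simp only [coeff_diagSeries_of_ne B _ hb.symm, zero_mul, Finset.sum_const_zero]
  · simp

lemma coeff_mul_diagSeries (B : ℕ → ℕ → ℕ → ℕ → A)
    (g : (Matrix (BlockIndex n μ) (BlockIndex n μ) A)⟦X⟧) (r : ℕ) (a : Fin n) (i : Fin (μ a))
    (x : BlockIndex n μ) :
    coeff r (g * diagSeries n μ B) x ⟨a, i⟩ =
      ∑ q : Fin (μ a), ∑ e ∈ Finset.range (r + 1), coeff e g x ⟨a, q⟩ * B a q i (r - e) := by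
  rw [coeff_mul_entry, Fintype.sum_sigma, Finset.sum_eq_single a]
  · simp only [coeff_diagSeries_self]
  · intro b _ hb
    simp only [coeff_diagSeries_of_ne B _ hb, mul_zero, Finset.sum_const_zero]
  · simp

lemma squareSeries_mul_eq_one {m : ℕ} {B B' : ℕ → ℕ → ℕ → A}
    (h : ∀ i j r, i < m → j < m →
      ∑ q ∈ Finset.range m, ∑ e ∈ Finset.range (r + 1), B i q e * B' q j (r - e) =
        if i = j ∧ r = 0 then 1 else 0) :
    squareSeries m B * squareSeries m B' = 1 := by
  refine PowerSeries.ext fun r => Matrix.ext fun i j => ?_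
  have hij := h i j r i.isLt j.isLt
  rw [Finset.sum_range] at hij
  simp only [coeff_mul_entry, coeff_squareSeries, hij, PowerSeries.coeff_one]
  rcases eq_or_ne r 0 with rfl | hr
  · simp [Matrix.one_apply, Fin.ext_iff]
  · simp [hr]

lemma diagSeries_mul_eq_one {B B' : ℕ → ℕ → ℕ → ℕ → A}
    (h : ∀ a < n, squareSeries (μ a) (B a) * squareSeries (μ a) (B' a) = 1) :
    diagSeries n μ B * diagSeries n μ B' = 1 := by
  refine PowerSeries.ext fun r => Matrix.ext ?_
  rintro ⟨a, i⟩ ⟨b, j⟩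
  rw [coeff_diagSeries_mul]
  rcases eq_or_ne a b with rfl | hab
  · have hij := Matrix.ext_iff.2 (congrArg (coeff r) (h a a.isLt)) i j
    simp only [coeff_mul_entry, coeff_squareSeries] at hij
    simp only [coeff_diagSeries_self, hij, PowerSeries.coeff_one]
    split_ifs <;> simp [Matrix.one_apply]
  · simp only [coeff_diagSeries_of_ne B' _ hab, mul_zero, Finset.sum_const_zero,
      PowerSeries.coeff_one]
    split_ifs <;> simp [hab]

lemma coeff_one_entry (a : Fin n) (i j : Fin (μ a)) (r : ℕ) :
    coeff r (1 : (Matrix (BlockIndex n μ) (BlockIndex n μ) A)⟦X⟧) ⟨a, i⟩ ⟨a, j⟩ =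
      if (i : ℕ) = j ∧ r = 0 then 1 else 0 := by
  rw [PowerSeries.coeff_one]
  rcases eq_or_ne r 0 with rfl | hr
  · simp [Matrix.one_apply, Fin.ext_iff]
  · simp [hr]

lemma coeff_blockSeries_eq_coeff_one {B : ℕ → ℕ → ℕ → ℕ → ℕ → A} {x y : BlockIndex n μ}
    (hdiag : ∀ i j r, B x.1 x.1 i j r = if i = j ∧ r = 0 then 1 else 0)
    (hzero : x.1 ≠ y.1 → ∀ i j r, B x.1 y.1 i j r = 0) (r : ℕ) :
    coeff r (blockSeries n μ B) x y =
      coeff r (1 : (Matrix (BlockIndex n μ) (BlockIndex n μ) A)⟦X⟧) x y := by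
  obtain ⟨a, i⟩ := x
  obtain ⟨b, j⟩ := y
  rw [coeff_blockSeries, PowerSeries.coeff_one]
  rcases eq_or_ne a b with rfl | hab
  · rw [hdiag, ← PowerSeries.coeff_one, coeff_one_entry]
  · rw [hzero hab]
    split_ifs <;> simp [hab]

lemma sum_delta_mul {m : ℕ} (i : Fin m) (f : Fin m → ℕ → A) (s : ℕ) :
    ∑ l : Fin m, ∑ e ∈ Finset.range (s + 1),
      (if (i : ℕ) = l ∧ e = 0 then 1 else 0) * f l (s - e) = f i s := by
  rw [Finset.sum_eq_single i, Finset.sum_eq_single 0]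
  · simp
  · intro e _ he
    simp [he]
  · simp
  · intro l _ hl
    simp [Fin.val_ne_of_ne hl.symm]
  · simp

lemma sum_mul_delta {m : ℕ} (k : Fin m) (f : Fin m → ℕ → A) (s : ℕ) :
    ∑ l : Fin m, ∑ e ∈ Finset.range (s + 1),
      f l e * (if (l : ℕ) = k ∧ s - e = 0 then 1 else 0) = f k s := by
  rw [Finset.sum_eq_single k, Finset.sum_eq_single s]
  · simp
  · intro e he hes
    have : s - e ≠ 0 := by
      have := Finset.mem_range.1 he
      omega
    simp [this]
  · simp
  · intro l _ hl
    simp [Fin.val_ne_of_ne hl]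
  · simp

end Blocks

namespace Gauss

variable [Ring A] [Algebra ℂ A] {n : ℕ} {μ : ℕ → ℕ} {T : ℕ → ℕ → ℕ → A} (G : Gauss T n μ)

lemma posSeries_eq : posSeries n μ T =
    blockSeries n μ G.F * (diagSeries n μ G.D * blockSeries n μ G.E) := by
  refine PowerSeries.ext fun r => Matrix.ext ?_
  rintro ⟨a, i⟩ ⟨b, j⟩
  rw [coeff_posSeries, pos, pos, G.decomp a b i j r a.isLt b.isLt i.isLt j.isLt, coeff_mul_entry,
    Fintype.sum_sigma, Finset.sum_range]
  refine Finset.sum_congr rfl fun c _ => ?_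
  rw [Finset.sum_range]
  refine Finset.sum_congr rfl fun q _ => ?_
  rw [Finset.sum_comm]
  refine Finset.sum_congr rfl fun e he => ?_
  have he' : r + 1 - e = r - e + 1 := by
    have := Finset.mem_range.1 he
    omega
  simp only [coeff_diagSeries_mul, coeff_blockSeries, Finset.sum_range (n := μ c), Finset.mul_sum,
    he', mul_assoc]

lemma squareSeries_D_mul_D' {a : ℕ} (ha : a < n) :
    squareSeries (μ a) (G.D a) * squareSeries (μ a) (G.D' a) = 1 :=
  squareSeries_mul_eq_one fun i j r => G.D_inv a i j r ha

lemma squareSeries_D'_mul_D {a : ℕ} (ha : a < n) :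
    squareSeries (μ a) (G.D' a) * squareSeries (μ a) (G.D a) = 1 :=
  squareSeries_mul_eq_one fun i j r => G.D_inv' a i j r ha

lemma coeff_zero_blockSeries_E : coeff 0 (blockSeries n μ G.E) = 1 := by
  ext ⟨a, i⟩ ⟨b, j⟩
  rw [coeff_blockSeries]
  rcases lt_trichotomy a b with hab | rfl | hab
  · rw [G.E_zero _ _ _ _ hab, Matrix.one_apply_ne]
    intro h
    exact hab.ne (congrArg Sigma.fst h)
  · simp [G.E_diag, Matrix.one_apply, Fin.ext_iff]
  · rw [G.E_low _ _ _ _ _ hab, Matrix.one_apply_ne]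
    intro h
    exact hab.ne' (congrArg Sigma.fst h)

lemma blockSeries_F_row_eq_one {a : Fin n} (ha : (a : ℕ) = 0) (i : Fin (μ a)) (r : ℕ)
    (z : BlockIndex n μ) : coeff r (blockSeries n μ G.F) ⟨a, i⟩ z =
      coeff r (1 : (Matrix (BlockIndex n μ) (BlockIndex n μ) A)⟦X⟧) ⟨a, i⟩ z := by
  refine coeff_blockSeries_eq_coeff_one (G.F_diag a) (fun h _ _ _ => G.F_high _ _ _ _ _ ?_) r
  have hne : (a : ℕ) ≠ z.1 := Fin.val_ne_of_ne h
  change (a : ℕ) < z.1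
  omega

lemma blockSeries_F_col_eq_one {a : Fin n} (ha : (a : ℕ) + 1 = n) (i : Fin (μ a)) (r : ℕ)
    (z : BlockIndex n μ) : coeff r (blockSeries n μ G.F) z ⟨a, i⟩ =
      coeff r (1 : (Matrix (BlockIndex n μ) (BlockIndex n μ) A)⟦X⟧) z ⟨a, i⟩ := by
  refine coeff_blockSeries_eq_coeff_one (G.F_diag z.1) (fun h _ _ _ => G.F_high _ _ _ _ _ ?_) r
  have hne : (z.1 : ℕ) ≠ a := Fin.val_ne_of_ne h
  change (z.1 : ℕ) < a
  omega

lemma blockSeries_E_row_eq_one {a : Fin n} (ha : (a : ℕ) + 1 = n) (i : Fin (μ a)) (r : ℕ)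
    (z : BlockIndex n μ) : coeff r (blockSeries n μ G.E) ⟨a, i⟩ z =
      coeff r (1 : (Matrix (BlockIndex n μ) (BlockIndex n μ) A)⟦X⟧) ⟨a, i⟩ z := by
  refine coeff_blockSeries_eq_coeff_one (G.E_diag a) (fun h _ _ _ => G.E_low _ _ _ _ _ ?_) r
  have hne : (a : ℕ) ≠ z.1 := Fin.val_ne_of_ne h
  change (z.1 : ℕ) < a
  omega

end Gauss

namespace Gauss

variable [Ring A] [Algebra ℂ A] {μ : ℕ → ℕ}

/-- `E_{1,b}(u) = D'_1(u) T_{1,b}(u)`. -/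
lemma E_first_row {n : ℕ} {T : ℕ → ℕ → ℕ → A} (G : Gauss T n μ) {a : Fin n} (ha : (a : ℕ) = 0)
    (i : Fin (μ a)) (y : BlockIndex n μ) (r : ℕ) :
    G.E a y.1 i y.2 r = ∑ q : Fin (μ a), ∑ e ∈ Finset.range (r + 1),
      G.D' a i q e * T (pos (⟨a, q⟩ : BlockIndex n μ)) (pos y) (r - e) := by
  have hDE : blockSeries n μ G.E =
      diagSeries n μ G.D' * (diagSeries n μ G.D * blockSeries n μ G.E) := by
    rw [← mul_assoc, diagSeries_mul_eq_one fun b hb => G.squareSeries_D'_mul_D hb, one_mul]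
  have h := Matrix.ext_iff.2 (congrArg (coeff r) hDE) ⟨a, i⟩ y
  rw [coeff_blockSeries, coeff_diagSeries_mul] at h
  rw [h]
  simp only [← coeff_posSeries (n := n) (μ := μ) T, G.posSeries_eq,
    coeff_mul_entry_of_row_eq_one (G.blockSeries_F_row_eq_one ha _)]

/-- The last block column of `E(v)⁻¹` is that of `T(v)⁻¹`, multiplied by the last diagonal
block of `D(v)`. -/
lemma coeff_E_inverse_last_col {n : ℕ} {T : ℕ → ℕ → ℕ → A} (G : Gauss T n μ) {a : Fin n}
    (ha : (a : ℕ) + 1 = n) (g : (Matrix (BlockIndex n μ) (BlockIndex n μ) A)⟦X⟧)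
    (x : BlockIndex n μ) (k : Fin (μ a)) (s : ℕ) :
    coeff s (g * blockSeries n μ G.F * diagSeries n μ G.D) x ⟨a, k⟩ =
      ∑ q : Fin (μ a), ∑ e ∈ Finset.range (s + 1), coeff e g x ⟨a, q⟩ * G.D a q k (s - e) := by
  simp only [coeff_mul_diagSeries,
    coeff_mul_entry_of_col_eq_one (G.blockSeries_F_col_eq_one ha _)]

lemma E_mul_eq_one {n : ℕ} {T : ℕ → ℕ → ℕ → A} (G : Gauss T n μ)
    {g : (Matrix (BlockIndex n μ) (BlockIndex n μ) A)⟦X⟧} (hg : g * posSeries n μ T = 1) :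
    blockSeries n μ G.E * (g * blockSeries n μ G.F * diagSeries n μ G.D) = 1 := by
  have hinv := mul_invOfUnit (blockSeries n μ G.E) 1 (by
    rw [← coeff_zero_eq_constantCoeff_apply, G.coeff_zero_blockSeries_E, Units.val_one])
  have hleft : g * blockSeries n μ G.F * diagSeries n μ G.D * blockSeries n μ G.E = 1 := by
    rw [← hg, G.posSeries_eq]
    simp only [mul_assoc]
  rw [left_inv_eq_right_inv hleft hinv, hinv]

/-- `E_2(v) E_3(v) - E_{2,4}(v)` is the block in position `(2, 4)` of `E(v)⁻¹`. -/
lemma coeff_inverse_E_one_three {T : ℕ → ℕ → ℕ → A} (G : Gauss T 4 μ)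
    {g : (Matrix (BlockIndex 4 μ) (BlockIndex 4 μ) A)⟦X⟧}
    (hg : blockSeries 4 μ G.E * g = 1) (h : Fin (μ 1)) (k : Fin (μ 3)) (s : ℕ) :
    (∑ q ∈ Finset.range (μ 2), ∑ c ∈ Finset.range (s + 1),
      G.E 1 2 h q c * G.E 2 3 q k (s - c)) - G.E 1 3 h k s =
    coeff s g ⟨1, h⟩ ⟨3, k⟩ := by
  have hlast : ∀ (l : Fin (μ 3)) (s : ℕ), coeff s g ⟨3, l⟩ ⟨3, k⟩ =
      if (l : ℕ) = k ∧ s = 0 then (1 : A) else 0 := by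
    intro l s
    refine .trans ?_ (coeff_one_entry (3 : Fin 4) l k s)
    rw [← hg]
    exact (coeff_mul_entry_of_row_eq_one
      (G.blockSeries_E_row_eq_one (a := 3) rfl l) g s ⟨3, k⟩).symm
  have hexpand : ∀ (x : BlockIndex 4 μ) (s : ℕ), x.1 ≠ 3 →
      (∑ l : Fin (μ 0), ∑ e ∈ Finset.range (s + 1),
        G.E x.1 0 x.2 l e * coeff (s - e) g ⟨0, l⟩ ⟨3, k⟩) +
      (∑ l : Fin (μ 1), ∑ e ∈ Finset.range (s + 1),
        G.E x.1 1 x.2 l e * coeff (s - e) g ⟨1, l⟩ ⟨3, k⟩) +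
      (∑ l : Fin (μ 2), ∑ e ∈ Finset.range (s + 1),
        G.E x.1 2 x.2 l e * coeff (s - e) g ⟨2, l⟩ ⟨3, k⟩) +
      G.E x.1 3 x.2 k s = 0 := by
    intro x s hx
    have H := Matrix.ext_iff.2 (congrArg (coeff s) hg) x ⟨3, k⟩
    have h1 : coeff s (1 : (Matrix (BlockIndex 4 μ) (BlockIndex 4 μ) A)⟦X⟧) x ⟨3, k⟩ = 0 := by
      rw [PowerSeries.coeff_one]
      split_ifs
      · exact Matrix.one_apply_ne fun h => hx (congrArg Sigma.fst h)
      · rfl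
    rw [h1, coeff_mul_entry, Fintype.sum_sigma, Fin.sum_univ_four] at H
    simp only [coeff_blockSeries] at H
    rw [← H]
    congr 1
    refine .trans (sum_mul_delta k (fun l e => G.E x.1 3 x.2 l e) s).symm ?_
    exact Finset.sum_congr rfl fun l _ => Finset.sum_congr rfl fun e _ =>
      congrArg _ (hlast l (s - e)).symm
  have hthird : ∀ (q : Fin (μ 2)) (s : ℕ), coeff s g ⟨2, q⟩ ⟨3, k⟩ = -G.E 2 3 q k s := by
    intro q s
    have H := hexpand ⟨2, q⟩ s (show (2 : Fin 4) ≠ 3 by decide)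
    have h0 : ∀ l e, G.E 2 0 q l e = 0 := fun _ _ => G.E_low _ _ _ _ _ (by decide)
    have h1 : ∀ l e, G.E 2 1 q l e = 0 := fun _ _ => G.E_low _ _ _ _ _ (by decide)
    simp only [Fin.isValue, Fin.coe_ofNat_eq_mod, Nat.reduceMod, h0, h1, zero_mul,
      Finset.sum_const_zero, zero_add, G.E_diag] at H
    rw [sum_delta_mul q (fun l e => coeff e g ⟨2, l⟩ ⟨3, k⟩) s] at H
    exact eq_neg_of_add_eq_zero_left H
  have H := hexpand ⟨1, h⟩ s (show (1 : Fin 4) ≠ 3 by decide)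
  have h0 : ∀ l e, G.E 1 0 h l e = 0 := fun _ _ => G.E_low _ _ _ _ _ (by decide)
  simp only [Fin.isValue, Fin.coe_ofNat_eq_mod, Nat.reduceMod, h0, zero_mul,
    Finset.sum_const_zero, zero_add, G.E_diag, hthird, mul_neg, Finset.sum_neg_distrib] at H
  rw [sum_delta_mul h (fun l e => coeff e g ⟨1, l⟩ ⟨3, k⟩) s] at H
  rw [Finset.sum_range, eq_comm, ← sub_eq_zero, ← H]
  abel

end Gauss

namespace RTT

variable [Ring A] [Algebra ℂ A] {d n : ℕ} {p : ℕ → ZMod 2} {μ : ℕ → ℕ}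

lemma coeff_zero_posSeries (S : RTT A d p) :
    coeff 0 (posSeries n μ S.t) = 1 := by
  ext x y
  rw [coeff_posSeries, S.t_zero, Matrix.one_apply]
  simp only [pos_injective.eq_iff]

lemma superCommute_inverse (S : RTT A d p) (hd : off μ n = d)
    {g : (Matrix (BlockIndex n μ) (BlockIndex n μ) A)⟦X⟧}
    (hfg : posSeries n μ S.t * g = 1) (hgf : g * posSeries n μ S.t = 1)
    {x y z w : BlockIndex n μ} (hy : z ≠ y) (hx : w ≠ x) (r s : ℕ) :
    SuperCommute (p (pos x) + p (pos y)) (p (pos z) + p (pos w)) (S.t (pos x) (pos y) r)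
      (coeff s g z w) := by
  subst hd
  rw [← coeff_posSeries (n := n) (μ := μ) S.t]
  refine superCommute_entry_inverse_entry (P := fun x => p (pos x)) S.coeff_zero_posSeries
    hfg hgf ?_ hy hx r s
  intro i j h k r s
  simp only [coeff_posSeries]
  exact S.rtt_succ (pos_lt i) (pos_lt j) (pos_lt h) (pos_lt k) r s

end RTT

namespace Gauss

variable [Ring A] [Algebra ℂ A] {d n : ℕ} {p : ℕ → ZMod 2} {μ : ℕ → ℕ}

/-- Entries of `D'_1(u)` and of `T(v)⁻¹` supercommute outside the first block row and column. -/
lemma superCommute_D'_first (S : RTT A d p) (G : Gauss S.t n μ) (hd : off μ n = d)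
    {g : (Matrix (BlockIndex n μ) (BlockIndex n μ) A)⟦X⟧}
    (hfg : posSeries n μ S.t * g = 1) (hgf : g * posSeries n μ S.t = 1)
    {a : Fin n} (ha : (a : ℕ) = 0) {z w : BlockIndex n μ} (hz : z.1 ≠ a) (hw : w.1 ≠ a)
    (i j : Fin (μ a)) (r s : ℕ) :
    SuperCommute (p (pos (⟨a, i⟩ : BlockIndex n μ)) + p (pos (⟨a, j⟩ : BlockIndex n μ)))
      (p (pos z) + p (pos w)) (G.D' a i j r) (coeff s g z w) := by
  let t₁₁ : ℕ → ℕ → ℕ → A := fun i j r => S.t (off μ a + i) (off μ a + j) r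
  have hleft : squareSeries (μ a) (G.D' a) * squareSeries (μ a) t₁₁ = 1 := by
    refine squareSeries_mul_eq_one fun k l r hk hl => ?_
    rw [← G.E_diag a k l r, Finset.sum_range]
    exact (G.E_first_row ha ⟨k, hk⟩ ⟨a, ⟨l, hl⟩⟩ r).symm
  have hDt : squareSeries (μ a) (G.D a) = squareSeries (μ a) t₁₁ :=
    left_inv_eq_right_inv (G.squareSeries_D_mul_D' a.isLt) hleft
  have hright : squareSeries (μ a) t₁₁ * squareSeries (μ a) (G.D' a) = 1 := by
    rw [← hDt, G.squareSeries_D_mul_D' a.isLt]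
  have H := SuperCommute.inverse_entry
    (P := fun i : Fin (μ a) => p (pos (⟨a, i⟩ : BlockIndex n μ)))
    (x := coeff s g z w) (b := p (pos z) + p (pos w)) hright hleft (fun r k l => ?_) r i j
  · rw [coeff_squareSeries] at H
    exact H.symm
  · rw [coeff_squareSeries]
    exact (S.superCommute_inverse hd hfg hgf (x := ⟨a, k⟩) (y := ⟨a, l⟩)
      (fun h => hz (congrArg Sigma.fst h)) (fun h => hw (congrArg Sigma.fst h)) r s).symm

lemma superCommute_E_first_row (S : RTT A d p) (G : Gauss S.t n μ) (hd : off μ n = d)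
    {g : (Matrix (BlockIndex n μ) (BlockIndex n μ) A)⟦X⟧}
    (hfg : posSeries n μ S.t * g = 1) (hgf : g * posSeries n μ S.t = 1)
    {a : Fin n} (ha : (a : ℕ) = 0) {y z w : BlockIndex n μ} (hz : z.1 ≠ a) (hw : w.1 ≠ a)
    (hzy : z.1 ≠ y.1) (i : Fin (μ a)) (r s : ℕ) :
    SuperCommute (p (pos (⟨a, i⟩ : BlockIndex n μ)) + p (pos y)) (p (pos z) + p (pos w))
      (G.E a y.1 i y.2 r) (coeff s g z w) := by
  rw [G.E_first_row ha]
  refine SuperCommute.sum_left fun q _ => SuperCommute.sum_left fun e _ => ?_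
  rw [← parity_add_cancel _ (p (pos (⟨a, q⟩ : BlockIndex n μ)))]
  exact (superCommute_D'_first S G hd hfg hgf ha hz hw i q e s).mul_left
    (S.superCommute_inverse hd hfg hgf (fun h => hzy (congrArg Sigma.fst h))
      (fun h => hw (congrArg Sigma.fst h)) _ s)

/-- The last diagonal block of `D(v)` is inverse to that of `T(v)⁻¹`, hence supercommutes with
whatever supercommutes with the latter. -/
lemma superCommute_D_last {T : ℕ → ℕ → ℕ → A} (G : Gauss T n μ)
    {g : (Matrix (BlockIndex n μ) (BlockIndex n μ) A)⟦X⟧} (hgf : g * posSeries n μ T = 1)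
    {a : Fin n} (ha : (a : ℕ) + 1 = n) {P : Fin (μ a) → ZMod 2} {b : ZMod 2} {x : A}
    (H : ∀ r k l, SuperCommute b (P k + P l) x (coeff r g ⟨a, k⟩ ⟨a, l⟩))
    (r : ℕ) (k l : Fin (μ a)) : SuperCommute b (P k + P l) x (G.D a k l r) := by
  let g' : (Matrix (Fin (μ a)) (Fin (μ a)) A)⟦X⟧ :=
    PowerSeries.mk fun r => Matrix.of fun k l => coeff r g ⟨a, k⟩ ⟨a, l⟩
  have hg' : ∀ r k l, coeff r g' k l = coeff r g ⟨a, k⟩ ⟨a, l⟩ := by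
    intro r k l
    rw [coeff_mk, Matrix.of_apply]
  have hright : g' * squareSeries (μ a) (G.D a) = 1 := by
    refine PowerSeries.ext fun r => Matrix.ext fun k l => ?_
    have h := coeff_mul_entry_of_row_eq_one (G.blockSeries_E_row_eq_one ha k)
      (g * blockSeries n μ G.F * diagSeries n μ G.D) r ⟨a, l⟩
    rw [G.E_mul_eq_one hgf, G.coeff_E_inverse_last_col ha, coeff_one_entry] at h
    simp only [coeff_mul_entry, hg', coeff_squareSeries]
    rw [← h, PowerSeries.coeff_one]
    rcases eq_or_ne r 0 with rfl | hr
    · simp [Matrix.one_apply, Fin.ext_iff]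
    · simp [hr]
  have hleft : squareSeries (μ a) (G.D a) * g' = 1 := by
    rw [left_inv_eq_right_inv hright (G.squareSeries_D_mul_D' a.isLt),
      G.squareSeries_D_mul_D' a.isLt]
  have h := SuperCommute.inverse_entry (P := P) (x := x) (b := b) hright hleft
    (fun r k l => (hg' r k l).symm ▸ H r k l) r k l
  rwa [coeff_squareSeries] at h

end Gauss

/-- For `μ = (μ 0, μ 1, μ 2, μ 3)`, in the super Yangian one has
`[E_{1,3;i,j}(u), Σ_q E_{2;h,q}(v) E_{3;q,k}(v) - E_{2,4;h,k}(v)] = 0`, stated as the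
vanishing of the coefficient of `u^{-r} v^{-s}` for all `r, s ≥ 0` (products in the
same variable `v` are expanded by convolution). -/
theorem statement19 [Ring A] [Algebra ℂ A] {d : ℕ} {p : ℕ → ZMod 2} {μ : ℕ → ℕ}
    (S : RTT A d p) (G : Gauss S.t 4 μ) (hd : off μ 4 = d) :
    ∀ i h j k r s : ℕ, i < μ 0 → h < μ 1 → j < μ 2 → k < μ 3 →
      scomm (sgn ((p (off μ 0 + i) + p (off μ 2 + j)) *
          (p (off μ 1 + h) + p (off μ 3 + k))))
        (G.E 0 2 i j r)
        ((∑ q ∈ Finset.range (μ 2), ∑ c ∈ Finset.range (s + 1),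
            G.E 1 2 h q c * G.E 2 3 q k (s - c)) - G.E 1 3 h k s) = 0 := by
  intro i h j k r s hi hh hj hk
  have h0 : constantCoeff (posSeries 4 μ S.t) =
      ((1 : (Matrix (BlockIndex 4 μ) (BlockIndex 4 μ) A)ˣ) :
        Matrix (BlockIndex 4 μ) (BlockIndex 4 μ) A) := by
    rw [← coeff_zero_eq_constantCoeff_apply, S.coeff_zero_posSeries, Units.val_one]
  obtain ⟨g, hfg, hgf⟩ : ∃ g, posSeries 4 μ S.t * g = 1 ∧ g * posSeries 4 μ S.t = 1 :=
    ⟨_, mul_invOfUnit _ 1 h0, invOfUnit_mul _ 1 h0⟩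
  have hE : ∀ {z w : BlockIndex 4 μ}, z.1 ≠ 0 → w.1 ≠ 0 → z.1 ≠ 2 → ∀ s,
      SuperCommute (p (off μ 0 + i) + p (off μ 2 + j)) (p (pos z) + p (pos w))
        (G.E 0 2 i j r) (coeff s g z w) := fun hz hw hzy s =>
    Gauss.superCommute_E_first_row S G hd hfg hgf (a := 0) (y := ⟨2, ⟨j, hj⟩⟩) rfl hz hw hzy
      ⟨i, hi⟩ r s
  have hD : ∀ (s : ℕ) (q l : Fin (μ 3)),
      SuperCommute (p (off μ 0 + i) + p (off μ 2 + j)) (p (off μ 3 + q) + p (off μ 3 + l))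
        (G.E 0 2 i j r) (G.D 3 q l s) :=
    G.superCommute_D_last hgf (a := 3) rfl (P := fun q : Fin (μ 3) => p (off μ 3 + q))
      fun s q l => hE (z := ⟨3, q⟩) (w := ⟨3, l⟩) (show (3 : Fin 4) ≠ 0 by decide)
        (show (3 : Fin 4) ≠ 0 by decide) (show (3 : Fin 4) ≠ 2 by decide) s
  refine sub_eq_zero.2 ?_
  rw [G.coeff_inverse_E_one_three (G.E_mul_eq_one hgf) ⟨h, hh⟩ ⟨k, hk⟩ s,
    G.coeff_E_inverse_last_col (a := 3) rfl g ⟨1, ⟨h, hh⟩⟩ ⟨k, hk⟩ s]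
  refine SuperCommute.symm (SuperCommute.sum_left fun q _ => SuperCommute.sum_left fun e _ => ?_)
  rw [← parity_add_cancel _ (p (off μ 3 + q))]
  exact (hE (z := ⟨1, ⟨h, hh⟩⟩) (w := ⟨3, q⟩) (show (1 : Fin 4) ≠ 0 by decide)
    (show (3 : Fin 4) ≠ 0 by decide) (show (1 : Fin 4) ≠ 2 by decide) e).symm.mul_left
    (hD (s - e) q ⟨k, hk⟩).symm

end SuperYangian
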